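/- Let m ≥ 3 be an integer. There do not exist pairs (a_i, b_i) ∈ ℂ² for i = 1, …, m with a_i b_j − a_j b_i ≠ 0 for all i ≠ j, satisfying all of the following determinant conditions: (i) for each 2 ≤ i ≤ m − 1, det [[a₁, b₁, 1], [a_i, b_i, 1], [a_{i+1}, b_{i+1}, 0]] = 0; (ii) det [[a₁, b₁, 1], [a_m, b_m, 1], [a₂, b₂, 0]] = 0; (iii) for all 2 ≤ i < j ≤ m, det [[a_i, b_i, 1], [a_j, b_j, 1], [a₁, b₁, 0]] = 0. (These conditions encode that the arrangement ℬ(m), consisting of the lines ℓ_i = V(a_i x + b_i y) and ℓ_i′ = V(a_i x + b_i y + z) together with the line z = 0, realizes the dependencies (ℓ₁′, ℓ_i′, ℓ_{i+1}) for 2 ≤ i ≤ m−1, (ℓ₁′, ℓ_m′, ℓ₂), and (ℓ₂′, …, ℓ_m′, ℓ₁); hence ℬ(m) is not realizable over ℂ.) -/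

import Mathlib

/-- For `m ≥ 3`, there are no pairs `(aᵢ, bᵢ) ∈ ℂ²`, `i = 1, …, m`, with
`aᵢbⱼ − aⱼbᵢ ≠ 0` for all `i ≠ j`, satisfying the determinantal conditions encoding the
dependencies `(ℓ₁′, ℓᵢ′, ℓ_{i+1})` for `2 ≤ i ≤ m−1`, `(ℓ₁′, ℓ_m′, ℓ₂)`, and
`(ℓ₂′, …, ℓ_m′, ℓ₁)` of the arrangement `ℬ(m)`; hence `ℬ(m)` is not realizable over `ℂ`. -/
theorem B_m_not_realizable (m : ℕ) (hm : 3 ≤ m) :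
    ¬ ∃ a b : ℕ → ℂ,
      (∀ i j, 1 ≤ i → 1 ≤ j → i ≤ m → j ≤ m → i ≠ j → a i * b j - a j * b i ≠ 0) ∧
      (∀ i, 2 ≤ i → i ≤ m - 1 →
        Matrix.det !![a 1, b 1, 1; a i, b i, 1; a (i + 1), b (i + 1), 0] = 0) ∧
      Matrix.det !![a 1, b 1, 1; a m, b m, 1; a 2, b 2, 0] = 0 ∧
      (∀ i j, 2 ≤ i → i < j → j ≤ m →
        Matrix.det !![a i, b i, 1; a j, b j, 1; a 1, b 1, 0] = 0) := by
  rintro ⟨a, b, hne, hstep, hlast, hpar⟩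
  simp [Matrix.det_fin_three] at hstep hlast hpar
  have hc : a 1 * b 2 - a 2 * b 1 ≠ 0 :=
    hne 1 2 le_rfl (by omega) (by omega) (by omega) (by omega)
  have hconst : ∀ i, 2 ≤ i → i ≤ m → a 1 * b i - a i * b 1 = a 1 * b 2 - a 2 * b 1 := by
    intro i h2 hi
    rcases h2.eq_or_lt with rfl | h2
    · rfl
    · linear_combination -hpar 2 i le_rfl h2 hi
  have harith : ∀ k : ℕ, k + 2 ≤ m →
      a 2 * b (k + 2) - a (k + 2) * b 2 = k * (a 1 * b 2 - a 2 * b 1) := by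
    intro k
    induction k with
    | zero => intro _; push_cast; ring
    | succ k ih =>
      intro hk
      have hs := hstep (k + 2) (by omega) (by omega)
      have h1 := hconst (k + 2) (by omega) (by omega)
      have h2 := hconst (k + 2 + 1) (by omega) (by omega)
      have hk' := ih (by omega)
      rw [show k + 1 + 2 = k + 2 + 1 by ring]
      push_cast
      -- The Plücker relation for the indices `1, 2, k + 2, k + 3`, divided by `[1, 2]`.
      have hadd : a (k + 2) * b (k + 2 + 1) - a (k + 2 + 1) * b (k + 2) =
          (a 2 * b (k + 2 + 1) - a (k + 2 + 1) * b 2) -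
            (a 2 * b (k + 2) - a (k + 2) * b 2) := by
        apply mul_left_cancel₀ hc
        linear_combination (a 2 * b (k + 2 + 1) - a (k + 2 + 1) * b 2) * h1 -
          (a 2 * b (k + 2) - a (k + 2) * b 2) * h2
      linear_combination hs + h2 - hadd + hk'
  obtain ⟨n, rfl⟩ := Nat.exists_eq_add_of_le' (show 2 ≤ m by omega)
  have hzero : ((n + 1 : ℕ) : ℂ) * (a 1 * b 2 - a 2 * b 1) = 0 := by
    push_cast
    linear_combination -hlast - harith n le_rfl
  exact mul_ne_zero (Nat.cast_ne_zero.mpr n.succ_ne_zero) hc hzero
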